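/- Let p₀,…,p₄ ∈ ℝ⁴ be affinely independent (a geometric 4-simplex), with outward unit facet normals N₀,…,N₄. Let Rₐ (a ∈ {0,…,4}) be 4×4 real matrices with RₐᵀRₐ = I₄ and det Rₐ = 1, and let αₐ ∈ {−1, 1} be signs such that Nₐ = αₐ·(Rₐ·e₀) for all a. For w ∈ ℝ⁴ write sp(w) := (w₁, w₂, w₃) ∈ ℝ³. For distinct a, b with complementary indices c < d < e, set Dₐ := det[sp(Rₐ⁻¹R_c·e₀), sp(Rₐ⁻¹R_d·e₀), sp(Rₐ⁻¹R_e·e₀)] and D_b := det[sp(R_b⁻¹R_c·e₀), sp(R_b⁻¹R_d·e₀), sp(R_b⁻¹R_e·e₀)] (3×3 determinants with the indicated columns). Then Dₐ ≠ 0, D_b ≠ 0, and αₐ·α_b·Dₐ·D_b < 0; equivalently αₐα_b = −sgn(Dₐ·D_b). (This is the content of Theorem 2.2 of the paper, identifying the sign factor β_{ab} in the explicit expression for the geometrical bivectors.) -/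

import Mathlib

open Matrix

/-- e₀ := (1,0,0,0) ∈ ℝ⁴. -/
def e0 : Fin 4 → ℝ := ![1, 0, 0, 0]

/-- The spatial part (w₁, w₂, w₃) ∈ ℝ³ of w ∈ ℝ⁴. -/
def sp (w : Fin 4 → ℝ) : Fin 3 → ℝ := fun i => w i.succ

/-- N is the outward unit normal to the a-th facet of the 4-simplex with vertices p. -/
def IsOutwardNormal (p : Fin 5 → Fin 4 → ℝ) (a : Fin 5) (N : Fin 4 → ℝ) : Prop :=
  N ⬝ᵥ N = 1 ∧ (∀ b c : Fin 5, b ≠ a → c ≠ a → N ⬝ᵥ (p b - p c) = 0) ∧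
    ∀ b : Fin 5, b ≠ a → N ⬝ᵥ (p a - p b) < 0

/-- Dₐ := det[sp(Rₐ⁻¹R_c·e₀), sp(Rₐ⁻¹R_d·e₀), sp(Rₐ⁻¹R_e·e₀)], a 3×3 determinant with
the indicated columns. -/
noncomputable def Ddet (R : Fin 5 → Matrix (Fin 4) (Fin 4) ℝ) (a c d e : Fin 5) : ℝ :=
  (Matrix.of fun i j =>
    ![sp (((R a)⁻¹ * R c).mulVec e0),
      sp (((R a)⁻¹ * R d).mulVec e0),
      sp (((R a)⁻¹ * R e).mulVec e0)] j i).det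


/-- The determinant with four given rows. -/
def D4 (u v w x : Fin 4 → ℝ) : ℝ := (Matrix.of ![u, v, w, x]).det

lemma D4_smul (s t r q : ℝ) (u v w x : Fin 4 → ℝ) :
    D4 (s • u) (t • v) (r • w) (q • x) = s * t * r * q * D4 u v w x := by
  simp [D4, Matrix.det_succ_row_zero, Fin.sum_univ_succ, Fin.succAbove]
  ring

lemma D4_mul (u v w x u' v' w' x' : Fin 4 → ℝ) :
    D4 u v w x * D4 u' v' w' x' =
      D4 ![u ⬝ᵥ u', u ⬝ᵥ v', u ⬝ᵥ w', u ⬝ᵥ x'] ![v ⬝ᵥ u', v ⬝ᵥ v', v ⬝ᵥ w', v ⬝ᵥ x']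
        ![w ⬝ᵥ u', w ⬝ᵥ v', w ⬝ᵥ w', w ⬝ᵥ x'] ![x ⬝ᵥ u', x ⬝ᵥ v', x ⬝ᵥ w', x ⬝ᵥ x'] := by
  unfold D4
  rw [← Matrix.det_transpose (Matrix.of ![u', v', w', x']), ← Matrix.det_mul]
  congr 1
  ext i j
  fin_cases i <;> fin_cases j <;> simp [Matrix.mul_apply, dotProduct]

lemma D4_tri (p q r s t u v : ℝ) :
    D4 ![p, t, u, v] ![0, q, 0, 0] ![0, 0, r, 0] ![0, 0, 0, s] = p * q * r * s := by
  simp [D4, Matrix.det_succ_row_zero, Fin.sum_univ_succ, Fin.succAbove]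
  ring

lemma D4_rot (Q : Matrix (Fin 4) (Fin 4) ℝ) (hQ : Q.det = 1) (u v w x : Fin 4 → ℝ) :
    D4 (Q.mulVec u) (Q.mulVec v) (Q.mulVec w) (Q.mulVec x) = D4 u v w x := by
  have h : Matrix.of ![Q.mulVec u, Q.mulVec v, Q.mulVec w, Q.mulVec x]
      = Matrix.of ![u, v, w, x] * Qᵀ := by
    ext i j
    fin_cases i <;> simp [Matrix.mul_apply, Matrix.mulVec, dotProduct, mul_comm]
  unfold D4
  rw [h, Matrix.det_mul, Matrix.det_transpose, hQ, mul_one]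

lemma D4_e0 (v w x : Fin 4 → ℝ) :
    D4 e0 v w x = (Matrix.of fun i j => ![sp v, sp w, sp x] j i).det := by
  simp [D4, e0, sp, Matrix.det_succ_row_zero, Fin.sum_univ_succ, Fin.succAbove]
  ring

lemma Ddet_eq (R : Fin 5 → Matrix (Fin 4) (Fin 4) ℝ) (hdet : ∀ a, (R a).det = 1)
    (a c d e : Fin 5) :
    Ddet R a c d e = D4 ((R a).mulVec e0) ((R c).mulVec e0) ((R d).mulVec e0)
      ((R e).mulVec e0) := by
  have hu : IsUnit (R a).det := by rw [hdet]; exact isUnit_one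
  unfold Ddet
  rw [← D4_e0, ← D4_rot (R a) (hdet a)]
  simp only [Matrix.mulVec_mulVec, ← Matrix.mul_assoc, Matrix.mul_nonsing_inv _ hu,
    Matrix.one_mul]

lemma five_distinct (a b c d e : Fin 5)
    (h : ({a, b, c, d, e} : Finset (Fin 5)) = Finset.univ) :
    a ≠ c ∧ a ≠ d ∧ a ≠ e ∧ b ≠ c ∧ b ≠ d ∧ b ≠ e := by
  have hc : ({a, b, c, d, e} : Finset (Fin 5)).card = 5 := by rw [h]; rfl
  refine ⟨?_, ?_, ?_, ?_, ?_, ?_⟩ <;> rintro rfl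
  · have := @Finset.card_le_four _ _ b a d e; simp only [Finset.mem_insert, Finset.mem_singleton, true_or, or_true, Finset.insert_eq_of_mem] at hc; grind
  · have := @Finset.card_le_four _ _ b c a e; simp only [Finset.mem_insert, Finset.mem_singleton, true_or, or_true, Finset.insert_eq_of_mem] at hc; grind
  · have := @Finset.card_le_four _ _ b c d a; simp only [Finset.mem_insert, Finset.mem_singleton, true_or, or_true, Finset.insert_eq_of_mem] at hc; grind
  · have := @Finset.card_le_four _ _ a b d e; simp only [Finset.mem_insert, Finset.mem_singleton, true_or, or_true, Finset.insert_eq_of_mem] at hc; grind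
  · have := @Finset.card_le_four _ _ a c b e; simp only [Finset.mem_insert, Finset.mem_singleton, true_or, or_true, Finset.insert_eq_of_mem] at hc; grind
  · have := @Finset.card_le_four _ _ a c d b; simp only [Finset.mem_insert, Finset.mem_singleton, true_or, or_true, Finset.insert_eq_of_mem] at hc; grind

lemma normals_sign (p : Fin 5 → Fin 4 → ℝ)
    (N : Fin 5 → Fin 4 → ℝ) (hN : ∀ a, IsOutwardNormal p a (N a))
    (a b c d e : Fin 5) (hab : a ≠ b) (hac : a ≠ c) (had : a ≠ d) (hae : a ≠ e)
    (hbc : b ≠ c) (hbd : b ≠ d) (hbe : b ≠ e) (hcd : c ≠ d) (hce : c ≠ e) (hde : d ≠ e) :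
    D4 (N a) (N c) (N d) (N e) * D4 (N b) (N c) (N d) (N e) < 0 := by
  have z : ∀ x y w, y ≠ x → w ≠ x → N x ⬝ᵥ (p y - p w) = 0 := fun x => (hN x).2.1
  have n : ∀ x y, y ≠ x → N x ⬝ᵥ (p x - p y) < 0 := fun x => (hN x).2.2
  have h1 := D4_mul (N a) (N c) (N d) (N e) (p a - p b) (p c - p b) (p d - p b) (p e - p b)
  have h2 := D4_mul (N b) (N c) (N d) (N e) (p a - p b) (p c - p b) (p d - p b) (p e - p b)
  rw [z c a b hac hbc, z c d b hcd.symm hbc, z c e b hce.symm hbc,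
    z d a b had hbd, z d c b hcd hbd, z d e b hde.symm hbd,
    z e a b hae hbe, z e c b hce hbe, z e d b hde hbe, D4_tri] at h1 h2
  have hc := n c b hbc
  have hd := n d b hbd
  have he := n e b hbe
  have ha := n a b hab.symm
  have hb : 0 < N b ⬝ᵥ (p a - p b) := by
    have := n b a hab
    rw [← neg_sub, dotProduct_neg] at this
    linarith
  have k1 : 0 < D4 (N a) (N c) (N d) (N e) *
      D4 (p a - p b) (p c - p b) (p d - p b) (p e - p b) := by
    rw [h1]
    exact mul_pos_of_neg_of_neg (mul_neg_of_pos_of_neg (mul_pos_of_neg_of_neg ha hc) hd) he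
  have k2 : D4 (N b) (N c) (N d) (N e) *
      D4 (p a - p b) (p c - p b) (p d - p b) (p e - p b) < 0 := by
    rw [h2]
    exact mul_neg_of_pos_of_neg (mul_pos_of_neg_of_neg (mul_neg_of_pos_of_neg hb hc) hd) he
  have k3 := mul_neg_of_pos_of_neg k1 k2
  by_contra hcon
  have := mul_nonneg (not_lt.mp hcon)
    (sq_nonneg (D4 (p a - p b) (p c - p b) (p d - p b) (p e - p b)))
  nlinarith

/-- Theorem 2.2 of the paper: for a geometric 4-simplex whose outward normals are
Nₐ = αₐ·Rₐ·e₀ with Rₐ ∈ SO(4) and αₐ = ±1, one has Dₐ ≠ 0, D_b ≠ 0,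
αₐα_b·Dₐ·D_b < 0, and αₐα_b = −sgn(Dₐ·D_b). -/
theorem geom_bivector_sign (p : Fin 5 → Fin 4 → ℝ) (hp : AffineIndependent ℝ p)
    (N : Fin 5 → Fin 4 → ℝ) (hN : ∀ a, IsOutwardNormal p a (N a))
    (R : Fin 5 → Matrix (Fin 4) (Fin 4) ℝ)
    (hR : ∀ a, (R a)ᵀ * R a = 1) (hdet : ∀ a, (R a).det = 1)
    (α : Fin 5 → ℝ) (hα : ∀ a, α a = 1 ∨ α a = -1)
    (hNa : ∀ a, N a = α a • (R a).mulVec e0)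
    (a b c d e : Fin 5) (hab : a ≠ b) (hcd : c < d) (hde : d < e)
    (hcompl : ({a, b, c, d, e} : Finset (Fin 5)) = Finset.univ) :
    Ddet R a c d e ≠ 0 ∧ Ddet R b c d e ≠ 0 ∧
    α a * α b * Ddet R a c d e * Ddet R b c d e < 0 ∧
    α a * α b = -Real.sign (Ddet R a c d e * Ddet R b c d e) := by
  obtain ⟨hac, had, hae, hbc, hbd, hbe⟩ := five_distinct a b c d e hcompl
  have key := normals_sign p N hN a b c d e hab hac had hae hbc hbd hbe hcd.ne
    (hcd.trans hde).ne hde.ne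
  rw [hNa a, hNa b, hNa c, hNa d, hNa e, D4_smul, D4_smul, ← Ddet_eq R hdet,
    ← Ddet_eq R hdet] at key
  have sq : ∀ x, α x * α x = 1 := fun x => by rcases hα x with h | h <;> rw [h] <;> norm_num
  have key2 : α a * α b * Ddet R a c d e * Ddet R b c d e < 0 := by
    calc α a * α b * Ddet R a c d e * Ddet R b c d e
        = α a * α b * Ddet R a c d e * Ddet R b c d e * (α c * α c) * (α d * α d)
          * (α e * α e) := by rw [sq, sq, sq]; ring
      _ = _ := by ring
      _ < 0 := key
  clear key
  refine ⟨fun h => by simp [h] at key2, fun h => by simp [h] at key2, key2, ?_⟩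
  have hs : α a * α b = 1 ∨ α a * α b = -1 := by
    rcases hα a with h | h <;> rcases hα b with h' | h' <;> rw [h, h'] <;> norm_num
  rw [mul_assoc] at key2
  rcases hs with h | h <;> rw [h] at key2 ⊢
  · rw [Real.sign_of_neg (by linarith)]; norm_num
  · rw [Real.sign_of_pos (by linarith)]
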